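/- For each i ≥ 1 and j ≥ 0, the subspace M_i(j) of monomials of Brown-Gitler filtration exactly 2^{i+1} j is an A(i)_*-subcomodule of (A // A(i))_*, and there is an isomorphism of graded A(i)_*-comodules M_i(j) ≅ Σ^{2^{i+1} j} N_{i-1}(j). Consequently there is a splitting of A(i)_*-comodules (A // A(i))_* ≅ ⊕_{j ≥ 0} M_i(j). -/

import Mathlib

open TensorProduct

/-- The mod 2 dual Steenrod algebra on the conjugate generators:
`MvPolynomial.X k` represents `ξ̄_{k+1}`. -/
abbrev DualSteenrod : Type := MvPolynomial ℕ (ZMod 2)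

/-- `xb k = ξ̄_k`, with `ξ̄_0 = 1`. -/
noncomputable def xb : ℕ → DualSteenrod
  | 0 => 1
  | k + 1 => MvPolynomial.X k

/-- The coproduct: `ψ(ξ̄_k) = Σ_{k₁+k₂=k} ξ̄_{k₁} ⊗ ξ̄_{k₂}^{2^{k₁}}`. -/
noncomputable def psi : DualSteenrod →ₐ[ZMod 2] DualSteenrod ⊗[ZMod 2] DualSteenrod :=
  MvPolynomial.aeval fun n =>
    ∑ p ∈ Finset.range (n + 2), (xb p) ⊗ₜ[ZMod 2] ((xb (n + 1 - p)) ^ (2 ^ p))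

/-- The ideal cutting out the quotient Hopf algebra `A(i)_*`. -/
noncomputable def steenrodIdeal (i : ℕ) : Ideal DualSteenrod :=
  Ideal.span (Set.range fun k : ℕ => (MvPolynomial.X k : DualSteenrod) ^ (2 ^ (i + 1 - k)))

abbrev Aquot (i : ℕ) : Type := DualSteenrod ⧸ steenrodIdeal i

/-- The left `A(i)_*`-coaction on `A_*`. -/
noncomputable def coact (i : ℕ) : DualSteenrod →ₐ[ZMod 2] Aquot i ⊗[ZMod 2] DualSteenrod :=
  (Algebra.TensorProduct.map (Ideal.Quotient.mkₐ (ZMod 2) (steenrodIdeal i))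
    (AlgHom.id (ZMod 2) DualSteenrod)).comp psi

/-- Brown-Gitler weight: `ξ̄_{k+1}` has weight `2^k`. -/
def bgWeight (d : ℕ →₀ ℕ) : ℕ := d.sum fun k e => e * 2 ^ k

/-- Internal (topological) degree of a monomial: `ξ̄_{k+1}` has degree `2^{k+1}-1`. -/
def intDegree (d : ℕ →₀ ℕ) : ℕ := d.sum fun k e => e * (2 ^ (k + 1) - 1)

/-- Monomials of `(A ⫽ A(i))_*`. -/
def isAAmonomial (i : ℕ) (d : ℕ →₀ ℕ) : Prop := ∀ k, 2 ^ (i + 1 - k) ∣ d k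

/-- The Brown-Gitler comodule `N_i(j)`. -/
noncomputable def BrownGitlerN (i j : ℕ) : Submodule (ZMod 2) DualSteenrod :=
  Submodule.span (ZMod 2)
    {m | ∃ d : ℕ →₀ ℕ, isAAmonomial i d ∧ bgWeight d ≤ 2 ^ (i + 1) * j ∧
      m = MvPolynomial.monomial d 1}

/-- `M_i(j)`: span of monomials of `(A ⫽ A(i))_*` of weight exactly `2^{i+1} j`. -/
noncomputable def BrownGitlerM (i j : ℕ) : Submodule (ZMod 2) DualSteenrod :=
  Submodule.span (ZMod 2)
    {m | ∃ d : ℕ →₀ ℕ, isAAmonomial i d ∧ bgWeight d = 2 ^ (i + 1) * j ∧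
      m = MvPolynomial.monomial d 1}

/-- The ring map `φ_i`, `ξ̄_k ↦ ξ̄_{k-1}`. -/
noncomputable def phi : DualSteenrod →ₐ[ZMod 2] DualSteenrod :=
  MvPolynomial.aeval fun k => xb k

/-- The subalgebra `(A ⫽ A(i))_*`. -/
noncomputable def AmodAi (i : ℕ) : Subalgebra (ZMod 2) DualSteenrod :=
  Algebra.adjoin (ZMod 2)
    (Set.range fun k : ℕ => (MvPolynomial.X k : DualSteenrod) ^ (2 ^ (i + 1 - k)))

section BrownGitler

open MvPolynomial

lemma bgWeight_eq_weight (d : ℕ →₀ ℕ) : bgWeight d = Finsupp.weight (fun k => 2 ^ k) d := rfl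

lemma intDegree_eq_weight (d : ℕ →₀ ℕ) :
    intDegree d = Finsupp.weight (fun k => 2 ^ (k + 1) - 1) d := rfl

lemma bgWeight_add (d e : ℕ →₀ ℕ) : bgWeight (d + e) = bgWeight d + bgWeight e := by
  simp only [bgWeight_eq_weight, map_add]

lemma bgWeight_single (k n : ℕ) : bgWeight (Finsupp.single k n) = n * 2 ^ k := by
  simp [bgWeight]

lemma intDegree_add (d e : ℕ →₀ ℕ) : intDegree (d + e) = intDegree d + intDegree e := by
  simp only [intDegree_eq_weight, map_add]

lemma intDegree_single (k n : ℕ) :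
    intDegree (Finsupp.single k n) = n * (2 ^ (k + 1) - 1) := by
  simp [intDegree]

lemma isAAmonomial_zero (i : ℕ) : isAAmonomial i 0 := fun _ => by simp

lemma isAAmonomial.add {i : ℕ} {d e : ℕ →₀ ℕ} (hd : isAAmonomial i d)
    (he : isAAmonomial i e) : isAAmonomial i (d + e) :=
  fun k => dvd_add (hd k) (he k)

lemma isAAmonomial_single {i k n : ℕ} (h : 2 ^ (i + 1 - k) ∣ n) :
    isAAmonomial i (Finsupp.single k n) := by
  intro l
  rcases eq_or_ne k l with rfl | hkl
  · simpa using h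
  · simp [Finsupp.single_eq_of_ne hkl.symm]

lemma two_pow_dvd_mul_two_pow {i k n : ℕ} (h : 2 ^ (i + 1 - k) ∣ n) :
    2 ^ (i + 1) ∣ n * 2 ^ k := by
  refine (pow_dvd_pow 2 (by omega : i + 1 ≤ (i + 1 - k) + k)).trans ?_
  rw [pow_add]
  exact mul_dvd_mul_right h _

lemma isAAmonomial.dvd_bgWeight {i : ℕ} {d : ℕ →₀ ℕ} (hd : isAAmonomial i d) :
    2 ^ (i + 1) ∣ bgWeight d :=
  Finset.dvd_sum fun k _ => two_pow_dvd_mul_two_pow (hd k)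

/-- The exponent of `ξ̄_1 ^ n` times the monomial `e` with all indices raised by one. -/
noncomputable def consExponent (n : ℕ) (e : ℕ →₀ ℕ) : ℕ →₀ ℕ :=
  Finsupp.single 0 n + e.mapDomain Nat.succ

@[simp]
lemma consExponent_zero (n : ℕ) (e : ℕ →₀ ℕ) : consExponent n e 0 = n := by
  simp [consExponent, Finsupp.mapDomain_of_notMem_range]

@[simp]
lemma consExponent_succ (n : ℕ) (e : ℕ →₀ ℕ) (k : ℕ) : consExponent n e (k + 1) = e k := by
  have := Finsupp.mapDomain_apply Nat.succ_injective e k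
  simpa [consExponent] using this

lemma exists_eq_consExponent (d : ℕ →₀ ℕ) : ∃ n e, d = consExponent n e := by
  refine ⟨d 0, d.comapDomain Nat.succ Nat.succ_injective.injOn, ?_⟩
  ext k
  cases k <;> simp

lemma weight_mapDomain_succ (w : ℕ → ℕ) (e : ℕ →₀ ℕ) :
    Finsupp.weight w (e.mapDomain Nat.succ) = Finsupp.weight (fun k => w (k + 1)) e :=
  Finsupp.linearCombination_mapDomain ℕ Nat.succ e

lemma bgWeight_consExponent (n : ℕ) (e : ℕ →₀ ℕ) :
    bgWeight (consExponent n e) = n + 2 * bgWeight e := by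
  rw [consExponent, bgWeight_add, bgWeight_single, bgWeight_eq_weight, weight_mapDomain_succ]
  simp only [bgWeight_eq_weight, Finsupp.weight_apply, Finsupp.sum,
    smul_eq_mul, Finset.mul_sum, pow_succ]
  ring_nf

lemma intDegree_consExponent (n : ℕ) (e : ℕ →₀ ℕ) :
    intDegree (consExponent n e) = intDegree e + bgWeight (consExponent n e) := by
  rw [bgWeight_consExponent, consExponent, intDegree_add, intDegree_single,
    intDegree_eq_weight (e.mapDomain Nat.succ), weight_mapDomain_succ]
  simp only [intDegree_eq_weight, bgWeight_eq_weight,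
    Finsupp.weight_apply, Finsupp.sum, smul_eq_mul, Finset.mul_sum]
  rw [add_left_comm, ← Finset.sum_add_distrib]
  simp only [zero_add, pow_one, Nat.add_one_sub_one, mul_one]
  congr 1
  refine Finset.sum_congr rfl fun k _ => ?_
  have h : 2 ^ (k + 1 + 1) - 1 = (2 ^ (k + 1) - 1) + 2 * 2 ^ k := by
    have := Nat.one_le_two_pow (n := k)
    simp only [pow_succ]
    omega
  rw [h]
  ring

lemma isAAmonomial_consExponent {i n : ℕ} {e : ℕ →₀ ℕ} :
    isAAmonomial (i + 1) (consExponent n e) ↔ 2 ^ (i + 2) ∣ n ∧ isAAmonomial i e := by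
  refine ⟨fun h => ⟨by simpa using h 0, fun k => by simpa using h (k + 1)⟩, fun h k => ?_⟩
  cases k with
  | zero => simpa using h.1
  | succ k => simpa using h.2 k

lemma phi_X (k : ℕ) : phi (X k) = xb k := by simp [phi]

lemma phi_monomial_consExponent (n : ℕ) (e : ℕ →₀ ℕ) :
    phi (monomial (consExponent n e) 1) = monomial e 1 := by
  have h : (monomial (consExponent n e) 1 : DualSteenrod) = X 0 ^ n * rename Nat.succ
      (monomial e 1) := by
    rw [rename_monomial, X_pow_eq_monomial, monomial_mul, one_mul, consExponent]
  have h' : phi.comp (rename Nat.succ) = AlgHom.id (ZMod 2) DualSteenrod := by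
    ext k : 1
    simp [phi_X, xb]
  rw [h, map_mul, map_pow, phi_X, xb, one_pow, one_mul]
  exact DFunLike.congr_fun h' _

lemma monomial_mem_BrownGitlerM {i j : ℕ} {d : ℕ →₀ ℕ} (hd : isAAmonomial i d)
    (hw : bgWeight d = 2 ^ (i + 1) * j) :
    (monomial d 1 : DualSteenrod) ∈ BrownGitlerM i j :=
  Submodule.subset_span ⟨d, hd, hw, rfl⟩

lemma map_phi_BrownGitlerM (i j : ℕ) :
    Submodule.map phi.toLinearMap (BrownGitlerM (i + 1) j) = BrownGitlerN i j := by
  rw [BrownGitlerM, BrownGitlerN, Submodule.map_span]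
  congr 1
  ext m
  constructor
  · rintro ⟨_, ⟨d, hd, hw, rfl⟩, rfl⟩
    obtain ⟨n, e, rfl⟩ := exists_eq_consExponent d
    rw [bgWeight_consExponent, pow_succ] at hw
    refine ⟨e, (isAAmonomial_consExponent.1 hd).2, ?_, phi_monomial_consExponent n e⟩
    linarith
  · rintro ⟨e, he, hw, rfl⟩
    have hsum : bgWeight e + (2 ^ (i + 1) * j - bgWeight e) = 2 ^ (i + 1) * j := by omega
    refine ⟨_, ⟨consExponent (2 * (2 ^ (i + 1) * j - bgWeight e)) e, ?_, ?_, rfl⟩,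
      phi_monomial_consExponent _ e⟩
    · refine isAAmonomial_consExponent.2 ⟨?_, he⟩
      rw [pow_succ' 2 (i + 1)]
      exact mul_dvd_mul_left 2 (Nat.dvd_sub (dvd_mul_right _ _) he.dvd_bgWeight)
    · rw [bgWeight_consExponent, pow_succ' 2 (i + 1), mul_assoc]
      omega

/-- The linear section of `phi` with values in polynomials of Brown-Gitler weight `w`. -/
noncomputable def phiSection (w : ℕ) : DualSteenrod →ₗ[ZMod 2] DualSteenrod :=
  (basisMonomials ℕ (ZMod 2)).constr (ZMod 2) fun e =>
    monomial (consExponent (w - 2 * bgWeight e) e) 1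

lemma phiSection_monomial (w : ℕ) (e : ℕ →₀ ℕ) :
    phiSection w (monomial e 1) = monomial (consExponent (w - 2 * bgWeight e) e) 1 := by
  exact (basisMonomials ℕ (ZMod 2)).constr_basis (ZMod 2) _ e

lemma phiSection_phi {i j : ℕ} {x : DualSteenrod} (hx : x ∈ BrownGitlerM i j) :
    phiSection (2 ^ (i + 1) * j) (phi x) = x := by
  have h : Set.EqOn (phiSection (2 ^ (i + 1) * j) ∘ₗ phi.toLinearMap)
      (LinearMap.id : DualSteenrod →ₗ[ZMod 2] DualSteenrod)
      (BrownGitlerM i j) := by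
    refine LinearMap.eqOn_span' ?_
    rintro _ ⟨d, -, hw, rfl⟩
    obtain ⟨n, e, rfl⟩ := exists_eq_consExponent d
    rw [bgWeight_consExponent] at hw
    simp only [LinearMap.comp_apply, AlgHom.toLinearMap_apply, phi_monomial_consExponent,
      phiSection_monomial, LinearMap.id_apply]
    rw [← hw, Nat.add_sub_cancel]
  exact h hx

lemma iSup_BrownGitlerM (i : ℕ) :
    iSup (fun j => BrownGitlerM i j) = Subalgebra.toSubmodule (AmodAi i) := by
  apply le_antisymm
  · refine iSup_le fun j => Submodule.span_le.2 ?_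
    rintro _ ⟨d, hd, -, rfl⟩
    rw [monomial_eq, C_1, one_mul]
    refine Subalgebra.prod_mem _ fun k _ => ?_
    obtain ⟨c, hc⟩ := hd k
    simp only [hc, pow_mul]
    exact Subalgebra.pow_mem _ (Algebra.subset_adjoin (Set.mem_range_self k)) c
  · rw [AmodAi, Algebra.adjoin_eq_span, Submodule.span_le]
    intro x hx
    have h : ∃ d, isAAmonomial i d ∧ x = monomial d 1 := by
      induction hx using Submonoid.closure_induction with
      | mem x hx =>
        obtain ⟨k, rfl⟩ := hx
        exact ⟨Finsupp.single k (2 ^ (i + 1 - k)), isAAmonomial_single dvd_rfl, X_pow_eq_monomial⟩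
      | one => exact ⟨0, isAAmonomial_zero i, rfl⟩
      | mul x y _ _ hx hy =>
        obtain ⟨d, hd, rfl⟩ := hx
        obtain ⟨e, he, rfl⟩ := hy
        exact ⟨d + e, hd.add he, by rw [monomial_mul, one_mul]⟩
    obtain ⟨d, hd, rfl⟩ := h
    obtain ⟨j, hj⟩ := hd.dvd_bgWeight
    exact Submodule.mem_iSup_of_mem j (monomial_mem_BrownGitlerM hd hj)

lemma BrownGitlerM_le_AmodAi (i j : ℕ) :
    BrownGitlerM i j ≤ Subalgebra.toSubmodule (AmodAi i) :=
  iSup_BrownGitlerM i ▸ le_iSup (fun j => BrownGitlerM i j) j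

lemma iSupIndep_BrownGitlerM (i : ℕ) : iSupIndep (fun j => BrownGitlerM i j) := by
  let w : ℕ → ℕ := fun k => 2 ^ k
  let _ := weightedGradedAlgebra (ZMod 2) w
  have h : iSupIndep (weightedHomogeneousSubmodule (ZMod 2) w) :=
    (DirectSum.Decomposition.isInternal _).submodule_iSupIndep
  have hinj : Function.Injective fun j => 2 ^ (i + 1) * j :=
    fun a b hab => Nat.eq_of_mul_eq_mul_left (by positivity) hab
  refine (h.comp hinj).mono fun j => Submodule.span_le.2 ?_
  rintro _ ⟨d, -, hw, rfl⟩
  exact isWeightedHomogeneous_monomial w d 1 hw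

section Coaction

variable {Q : Type*} [CommRing Q] [Algebra (ZMod 2) Q]

/-- The span of the tensors `q ⊗ m` with `m` a monomial of `(A ⫽ A(i))_*` of weight `w`. -/
noncomputable def tensorWeightSpan (Q : Type*) [CommRing Q] [Algebra (ZMod 2) Q] (i w : ℕ) :
    Submodule (ZMod 2) (Q ⊗[ZMod 2] DualSteenrod) :=
  Submodule.span (ZMod 2) {t | ∃ q : Q, ∃ d : ℕ →₀ ℕ, isAAmonomial i d ∧ bgWeight d = w ∧
    t = q ⊗ₜ[ZMod 2] monomial d 1}

instance tensorWeightSpan_gradedMonoid (i : ℕ) :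
    SetLike.GradedMonoid (tensorWeightSpan Q i) where
  one_mem := Submodule.subset_span ⟨1, 0, isAAmonomial_zero i, rfl, rfl⟩
  mul_mem := by
    intro v w x y hx hy
    have h := Submodule.mul_mem_mul hx hy
    rw [tensorWeightSpan, tensorWeightSpan, Submodule.span_mul_span] at h
    refine Submodule.span_mono ?_ h
    rintro _ ⟨_, ⟨q, d, hd, rfl, rfl⟩, _, ⟨r, e, he, rfl, rfl⟩, rfl⟩
    refine ⟨q * r, d + e, hd.add he, bgWeight_add d e, ?_⟩
    simp only [Algebra.TensorProduct.tmul_mul_tmul, monomial_mul, one_mul]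

/-- The left coaction on `A_*` of a quotient `π : A_* → Q`. -/
noncomputable def coactAlong (π : DualSteenrod →ₐ[ZMod 2] Q) :
    DualSteenrod →ₐ[ZMod 2] Q ⊗[ZMod 2] DualSteenrod :=
  (Algebra.TensorProduct.map π (AlgHom.id (ZMod 2) DualSteenrod)).comp psi

lemma psi_xb (k : ℕ) :
    psi (xb k) = ∑ p ∈ Finset.range (k + 1), xb p ⊗ₜ[ZMod 2] (xb (k - p) ^ 2 ^ p) := by
  cases k with
  | zero => simp [xb, Algebra.TensorProduct.one_def]
  | succ k => simp [xb, psi]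

lemma coactAlong_xb_pow (π : DualSteenrod →ₐ[ZMod 2] Q) (k m : ℕ) :
    coactAlong π (xb k ^ 2 ^ m) = ∑ p ∈ Finset.range (k + 1),
      (π (xb p) ^ 2 ^ m) ⊗ₜ[ZMod 2] (xb (k - p) ^ 2 ^ (p + m)) := by
  have h : coactAlong π (xb k) = ∑ p ∈ Finset.range (k + 1),
      π (xb p) ⊗ₜ[ZMod 2] (xb (k - p) ^ 2 ^ p) := by
    simp [coactAlong, psi_xb]
  rcases subsingleton_or_nontrivial (Q ⊗[ZMod 2] DualSteenrod) with _ | _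
  · exact Subsingleton.elim _ _
  have : CharP (Q ⊗[ZMod 2] DualSteenrod) 2 := charP_of_injective_algebraMap' (ZMod 2) 2
  rw [map_pow, h, sum_pow_char_pow]
  simp only [Algebra.TensorProduct.tmul_pow, ← pow_mul, ← pow_add]

lemma coactAlong_X_pow {π : DualSteenrod →ₐ[ZMod 2] Q} {i : ℕ}
    (hπ : ∀ k, π (X k ^ 2 ^ (i + 1 - k)) = 0) (k : ℕ) :
    coactAlong π (X k ^ 2 ^ (i + 1 - k)) = ∑ p ∈ Finset.range (k + 1),
      (π (xb p) ^ 2 ^ (i + 1 - k)) ⊗ₜ[ZMod 2] (X (k - p) ^ 2 ^ (p + (i + 1 - k))) := by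
  have h0 : π (xb (k + 1)) ^ 2 ^ (i + 1 - k) = 0 := by
    rw [← map_pow]
    exact hπ k
  have h := coactAlong_xb_pow π (k + 1) (i + 1 - k)
  rw [Finset.sum_range_succ, h0, TensorProduct.zero_tmul, add_zero] at h
  refine h.trans (Finset.sum_congr rfl fun p hp => ?_)
  rw [Nat.succ_sub (Finset.mem_range_succ_iff.1 hp)]
  rfl

lemma coactAlong_X_pow_mem {π : DualSteenrod →ₐ[ZMod 2] Q} {i : ℕ}
    (hπ : ∀ k, π (X k ^ 2 ^ (i + 1 - k)) = 0) (k : ℕ) :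
    coactAlong π (X k ^ 2 ^ (i + 1 - k)) ∈ tensorWeightSpan Q i (2 ^ (i + 1 - k) * 2 ^ k) := by
  rw [coactAlong_X_pow hπ]
  refine Submodule.sum_mem _ fun p hp => Submodule.subset_span
    ⟨_, Finsupp.single (k - p) (2 ^ (p + (i + 1 - k))), ?_, ?_, by rw [X_pow_eq_monomial]⟩
  · exact isAAmonomial_single (pow_dvd_pow 2 (by omega))
  · have := Finset.mem_range_succ_iff.1 hp
    rw [bgWeight_single, ← pow_add, ← pow_add]
    congr 1
    omega

lemma coactAlong_monomial_mem {π : DualSteenrod →ₐ[ZMod 2] Q} {i : ℕ}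
    (hπ : ∀ k, π (X k ^ 2 ^ (i + 1 - k)) = 0) {d : ℕ →₀ ℕ} (hd : isAAmonomial i d) :
    coactAlong π (monomial d 1) ∈ tensorWeightSpan Q i (bgWeight d) := by
  rw [monomial_eq, C_1, one_mul, Finsupp.prod, map_prod]
  refine SetLike.prod_mem_graded _ _ _ fun k _ => ?_
  obtain ⟨c, hc⟩ := hd k
  simp only [hc]
  rw [pow_mul, map_pow, mul_comm _ c, mul_assoc, ← smul_eq_mul c]
  exact SetLike.pow_mem_graded c (coactAlong_X_pow_mem hπ k)

lemma coactAlong_mem {π : DualSteenrod →ₐ[ZMod 2] Q} {i : ℕ}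
    (hπ : ∀ k, π (X k ^ 2 ^ (i + 1 - k)) = 0) {j : ℕ} {x : DualSteenrod}
    (hx : x ∈ BrownGitlerM i j) :
    coactAlong π x ∈ Submodule.span (ZMod 2) {t : Q ⊗[ZMod 2] DualSteenrod |
      ∃ q : Q, ∃ n ∈ BrownGitlerM i j, t = q ⊗ₜ[ZMod 2] n} := by
  have hM : BrownGitlerM i j ≤
      (tensorWeightSpan Q i (2 ^ (i + 1) * j)).comap (coactAlong π).toLinearMap := by
    refine Submodule.span_le.2 ?_
    rintro _ ⟨d, hd, hw, rfl⟩
    exact hw ▸ coactAlong_monomial_mem hπ hd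
  refine Submodule.span_mono ?_ (hM hx)
  rintro _ ⟨q, d, hd, hw, rfl⟩
  exact ⟨q, _, monomial_mem_BrownGitlerM hd hw, rfl⟩

lemma map_phi_coactAlong {π : DualSteenrod →ₐ[ZMod 2] Q} {i : ℕ}
    (hπ : ∀ k, π (X k ^ 2 ^ (i + 1 - k)) = 0) {x : DualSteenrod} (hx : x ∈ AmodAi i) :
    (TensorProduct.map (LinearMap.id : Q →ₗ[ZMod 2] Q) phi.toLinearMap)
      (coactAlong π x) = coactAlong π (phi x) := by
  have h : AmodAi i ≤ AlgHom.equalizer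
      ((Algebra.TensorProduct.map (AlgHom.id (ZMod 2) Q) phi).comp (coactAlong π))
      ((coactAlong π).comp phi) := by
    refine AlgHom.adjoin_le_equalizer _ _ ?_
    rintro _ ⟨k, rfl⟩
    simp only [AlgHom.comp_apply]
    rw [coactAlong_X_pow hπ, map_pow phi, phi_X, coactAlong_xb_pow, map_sum]
    simp only [Algebra.TensorProduct.map_tmul, map_pow phi, phi_X, AlgHom.id_apply]
  exact h hx

end Coaction

lemma mkₐ_steenrodIdeal_X_pow (i k : ℕ) :
    Ideal.Quotient.mkₐ (ZMod 2) (steenrodIdeal i) (X k ^ 2 ^ (i + 1 - k)) = 0 :=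
  Ideal.Quotient.eq_zero_iff_mem.2 (Ideal.subset_span ⟨k, rfl⟩)

end BrownGitler

/-- for `i ≥ 1` and every `j`:
(1) `M_i(j)` is an `A(i)_*`-subcomodule of `(A ⫽ A(i))_*`;
(2) `φ_i` is an isomorphism `M_i(j) ≅ Σ^{2^{i+1} j} N_{i-1}(j)` of graded
`A(i)_*`-comodules — it maps `M_i(j)` bijectively onto `N_{i-1}(j)`,
intertwines the `A(i)_*`-coactions, and lowers internal degree by exactly
`2^{i+1} j` on homogeneous elements;
(3) the `M_i(j)` give a splitting of `(A ⫽ A(i))_*` as an internal direct sum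
`(A ⫽ A(i))_* ≅ ⊕_{j ≥ 0} M_i(j)`. -/
theorem stmt7 (i : ℕ) (hi : 1 ≤ i) :
    (∀ j, ∀ x ∈ BrownGitlerM i j,
      coact i x ∈ Submodule.span (ZMod 2)
        {t : Aquot i ⊗[ZMod 2] DualSteenrod |
          ∃ q : Aquot i, ∃ n ∈ BrownGitlerM i j, t = q ⊗ₜ[ZMod 2] n}) ∧
    (∀ j, Submodule.map phi.toLinearMap (BrownGitlerM i j) = BrownGitlerN (i - 1) j ∧
      (∀ x ∈ BrownGitlerM i j, phi x = 0 → x = 0) ∧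
      (∀ x ∈ BrownGitlerM i j,
        (TensorProduct.map (LinearMap.id : Aquot i →ₗ[ZMod 2] Aquot i) phi.toLinearMap)
          (coact i x) = coact i (phi x)) ∧
      (∀ d : ℕ →₀ ℕ, isAAmonomial i d → bgWeight d = 2 ^ (i + 1) * j →
        ∀ e ∈ (phi (MvPolynomial.monomial d 1)).support,
          intDegree e + 2 ^ (i + 1) * j = intDegree d)) ∧
    (iSup (fun j => BrownGitlerM i j) = Subalgebra.toSubmodule (AmodAi i) ∧
      iSupIndep (fun j => BrownGitlerM i j)) := by
  obtain ⟨i, rfl⟩ := Nat.exists_eq_add_of_le' hi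
  have hπ := mkₐ_steenrodIdeal_X_pow (i + 1)
  refine ⟨fun j x hx => coactAlong_mem hπ hx,
    fun j => ⟨map_phi_BrownGitlerM i j, fun x hx h => ?_,
      fun x hx => map_phi_coactAlong hπ (BrownGitlerM_le_AmodAi _ j hx),
      fun d _ hw e he => ?_⟩,
    iSup_BrownGitlerM _, iSupIndep_BrownGitlerM _⟩
  · rw [← phiSection_phi hx, h, map_zero]
  · obtain ⟨n, d, rfl⟩ := exists_eq_consExponent d
    rw [phi_monomial_consExponent] at he
    obtain rfl := Finset.mem_singleton.1 (MvPolynomial.support_monomial_subset he)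
    rw [← hw, intDegree_consExponent]
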